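/- Let p ∈ (1,∞) and a > 0. Let y : [0, θ_a] → [0, a] be the inverse of the strictly decreasing function g(t) = ∫_t^a H_a(w)^{−1/2} dw, and extend y to [−θ_a, θ_a] by setting y(θ) = y(−θ) for θ ∈ [−θ_a, 0). Then the extended function y is three times continuously differentiable on [−θ_a, θ_a], satisfies 4 y(θ)²·[1 + 2 y(θ) + y''(θ)/p] + y'(θ)²·[1 + (2(3p−4)/p)·y(θ) + ((p−1)/p)·y''(θ)] = 0 for all θ ∈ (−θ_a, θ_a), and moreover y > 0 on (−θ_a, θ_a), y(±θ_a) = 0, y'(0) = 0, and y''(0) = −p(1+2a). -/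

import Mathlib

open Set Real Filter MeasureTheory

/-- `F_a(y,w)` from the paper (with parameter `p`). -/
noncomputable def Fa (p a y w : ℝ) : ℝ :=
  (8*p*(1/a + 2*y) + (2*p/a + 4*(3*p - 2)*y + 2*(p - 1)*y*w)*w) / (y^2 * (4 + (p - 1)*w))

/-- `G` is the family `a ↦ G_a` of solutions of `G_a' = -F_a(y, G_a)` on `(0,1)`
with `G_a(1) = 0`: each `G_a` is continuous on `(0,1]`, positive on `(0,1)` and
strictly decreasing on `(0,1]`. -/
def IsGFamily (p : ℝ) (G : ℝ → ℝ → ℝ) : Prop :=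
  ∀ a : ℝ, 0 < a →
    ContinuousOn (G a) (Set.Ioc 0 1) ∧
    G a 1 = 0 ∧
    (∀ y ∈ Set.Ioo (0:ℝ) 1, HasDerivAt (G a) (-(Fa p a y (G a y))) y) ∧
    (∀ y ∈ Set.Ioo (0:ℝ) 1, 0 < G a y) ∧
    StrictAntiOn (G a) (Set.Ioc 0 1)

/-- `H_a(y) = y² G_a(y/a)`. -/
noncomputable def Ha (G : ℝ → ℝ → ℝ) (a y : ℝ) : ℝ := y^2 * G a (y/a)

/-- `g(t) = ∫_t^a H_a(w)^{-1/2} dw`. -/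
noncomputable def gfun (G : ℝ → ℝ → ℝ) (a t : ℝ) : ℝ :=
  ∫ w in Set.Ioo t a, (Real.sqrt (Ha G a w))⁻¹

/-- `θ_a = ∫_0^a H_a(w)^{-1/2} dw`. -/
noncomputable def thetaA (G : ℝ → ℝ → ℝ) (a : ℝ) : ℝ := gfun G a 0

/-- A continuous function on a compact interval whose derivative agrees, off one point, with a
given continuous function has that function as its within-derivative on the whole interval. -/
lemma hasDerivWithinAt_Icc_of_hasDerivAt_off_point {f f' : ℝ → ℝ} {a b c : ℝ}
    (hf : ContinuousOn f (Icc a b)) (hf' : ContinuousOn f' (Icc a b))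
    (hd : ∀ x ∈ Ioo a b, x ≠ c → HasDerivAt f (f' x) x) {x : ℝ} (hx : x ∈ Icc a b) :
    HasDerivWithinAt f (f' x) (Icc a b) x := by
  have hab : a ≤ b := hx.1.trans hx.2
  set e : ℝ → ℝ := IccExtend hab ((Icc a b).domRestrict f') with he
  have hec : Continuous e := (continuousOn_iff_continuous_domRestrict.1 hf').Icc_extend'
  have heq : ∀ z ∈ Icc a b, e z = f' z := fun z hz => by
    rw [he, IccExtend_of_mem hab _ hz]; rfl
  have hF : ∀ z ∈ Icc a b, f z = f a + ∫ w in a..z, e w := by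
    intro z hz
    rw [integral_eq_of_hasDerivAt_off_countable_of_le f e hz.1 (countable_singleton c)
      (hf.mono (Icc_subset_Icc_right hz.2)) _ (hec.intervalIntegrable _ _)]
    · ring
    · intro w hw
      have hw' : w ∈ Ioo a b := ⟨hw.1.1, hw.1.2.trans_le hz.2⟩
      rw [heq w (Ioo_subset_Icc_self hw')]
      exact hd w hw' hw.2
  have hder := ((hec.integral_hasStrictDerivAt a x).hasDerivAt.const_add (f a)).hasDerivWithinAt
    (s := Icc a b)
  rw [heq x hx] at hder
  exact hder.congr hF (hF x hx)

/-- Differentiability of the inverse of `t ↦ ∫ w in t..a, k w` for a positive integrand `k`. -/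
lemma inverse_of_primitive {k g y : ℝ → ℝ} {a : ℝ} (ha : 0 < a)
    (hk : ContinuousOn k (Ioo 0 a)) (hkpos : ∀ t ∈ Ioo 0 a, 0 < k t)
    (hint : IntervalIntegrable k volume 0 a) (hg : ∀ t ∈ Icc 0 a, g t = ∫ w in t..a, k w)
    (hmaps : MapsTo y (Icc 0 (g 0)) (Icc 0 a))
    (hinv₁ : ∀ t ∈ Icc 0 a, y (g t) = t) (hinv₂ : ∀ s ∈ Icc 0 (g 0), g (y s) = s) :
    0 < g 0 ∧ ContinuousOn y (Icc 0 (g 0)) ∧ (∀ s ∈ Ioo 0 (g 0), y s ∈ Ioo 0 a) ∧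
      ∀ s ∈ Ioo 0 (g 0), HasDerivAt y (-(k (y s))⁻¹) s := by
  have hga : g a = 0 := by rw [hg a ⟨ha.le, le_rfl⟩, intervalIntegral.integral_same]
  have hgc : ContinuousOn g (Icc 0 a) := by
    have h := intervalIntegral.continuousOn_primitive_interval_left (f := k) (a := 0) (b := a)
      (μ := volume) (by
        rw [uIcc_of_le ha.le]
        exact (intervalIntegrable_iff_integrableOn_Icc_of_le ha.le).1 hint)
    rw [uIcc_of_le ha.le] at h
    exact h.congr hg
  have hgd : ∀ t ∈ Ioo 0 a, HasDerivAt g (-k t) t := by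
    intro t ht
    have h := intervalIntegral.integral_hasDerivAt_left (f := k) (a := t) (b := a)
      (hint.mono_set (by
        rw [uIcc_of_le ha.le, uIcc_of_le ht.2.le]; exact Icc_subset_Icc_left ht.1.le))
      (hk.stronglyMeasurableAtFilter isOpen_Ioo t ht) (hk.continuousAt (Ioo_mem_nhds ht.1 ht.2))
    refine h.congr_of_eventuallyEq ?_
    filter_upwards [Icc_mem_nhds ht.1 ht.2] with u hu using hg u hu
  have hanti : StrictAntiOn g (Icc 0 a) := by
    refine strictAntiOn_of_deriv_neg (convex_Icc 0 a) hgc fun t ht => ?_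
    rw [interior_Icc] at ht
    rw [(hgd t ht).deriv]
    exact neg_neg_of_pos (hkpos t ht)
  have hgmaps : ∀ t ∈ Icc 0 a, g t ∈ Icc 0 (g 0) := fun t ht =>
    ⟨hga ▸ hanti.antitoneOn ht ⟨ha.le, le_rfl⟩ ht.2,
      hanti.antitoneOn ⟨le_rfl, ha.le⟩ ht ht.1⟩
  have hpos : 0 < g 0 := by
    have := hanti ⟨le_rfl, ha.le⟩ ⟨ha.le, le_rfl⟩ ha
    rwa [hga] at this
  have hyc : ContinuousOn y (Icc 0 (g 0)) := by
    rw [continuousOn_iff_isClosed]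
    intro C hC
    refine ⟨g '' (C ∩ Icc 0 a), ((isCompact_Icc.inter_left hC).image_of_continuousOn
      (hgc.mono inter_subset_right)).isClosed, ?_⟩
    ext s
    constructor
    · rintro ⟨hs, hs'⟩
      exact ⟨⟨y s, ⟨hs, hmaps hs'⟩, hinv₂ s hs'⟩, hs'⟩
    · rintro ⟨⟨t, ⟨htC, ht⟩, rfl⟩, hs⟩
      refine ⟨?_, hs⟩
      rwa [mem_preimage, hinv₁ t ht]
  have hyI : ∀ s ∈ Ioo 0 (g 0), y s ∈ Ioo 0 a := by
    intro s hs
    have hs' := Ioo_subset_Icc_self hs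
    have h := hinv₂ s hs'
    refine ⟨(hmaps hs').1.lt_of_ne fun h0 => ?_, (hmaps hs').2.lt_of_ne fun h0 => ?_⟩
    · rw [← h0] at h; exact hs.2.ne h.symm
    · rw [h0, hga] at h; exact hs.1.ne h
  refine ⟨hpos, hyc, hyI, fun s hs => ?_⟩
  rw [← inv_neg]
  refine HasDerivAt.of_local_left_inverse (hyc.continuousAt (Icc_mem_nhds hs.1 hs.2))
    (hgd _ (hyI s hs)) (neg_ne_zero.2 (hkpos _ (hyI s hs)).ne') ?_
  filter_upwards [Icc_mem_nhds hs.1 hs.2] with u hu using hinv₂ u hu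

/-- The second derivative prescribed by the equation, as a function of the value `y` and of the
square `h` of the first derivative. -/
noncomputable def accel (p y h : ℝ) : ℝ :=
  -(4 * p * (1 + 2 * y) * y ^ 2 + p * h + (6 * p - 8) * y * h) / (4 * y ^ 2 + (p - 1) * h)

lemma hasDerivAt_Ha {p a : ℝ} {G : ℝ → ℝ → ℝ} (hp : 1 < p) (ha : 0 < a) (hG : IsGFamily p G)
    {t : ℝ} (ht : t ∈ Ioo 0 a) : HasDerivAt (Ha G a) (2 * accel p t (Ha G a t)) t := by
  obtain ⟨-, -, hd, hpos, -⟩ := hG a ha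
  have hu : t / a ∈ Ioo (0 : ℝ) 1 := ⟨div_pos ht.1 ha, (div_lt_one ha).2 ht.2⟩
  have h := (hasDerivAt_pow 2 t).mul
    ((hd _ hu).comp t ((hasDerivAt_id t).div_const a))
  refine h.congr_deriv ?_
  have hw := hpos _ hu
  have ht0 := ht.1
  simp only [Function.comp, Ha, accel, Fa, id]
  set w := G a (t / a)
  have h1 : 0 < 4 + (p - 1) * w := by nlinarith [mul_pos (sub_pos.2 hp) hw]
  have h2 : 4 * t ^ 2 + (p - 1) * (t ^ 2 * w) = t ^ 2 * (4 + (p - 1) * w) := by ring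
  rw [h2]
  generalize hD : 4 + (p - 1) * w = D at *
  field_simp
  subst hD
  push_cast
  ring

lemma Ha_pos {p a : ℝ} {G : ℝ → ℝ → ℝ} (ha : 0 < a) (hG : IsGFamily p G)
    {t : ℝ} (ht : t ∈ Ioo 0 a) : 0 < Ha G a t := by
  obtain ⟨-, -, -, hpos, -⟩ := hG a ha
  exact mul_pos (pow_pos ht.1 2) (hpos _ ⟨div_pos ht.1 ha, (div_lt_one ha).2 ht.2⟩)

lemma abs_accel_le {p a y h : ℝ} (hp : 1 < p) (hy : y ∈ Ioo 0 a) (hh : 0 < h) :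
    |accel p y h| ≤ p * (1 + 2 * a) + (p + (6 * p + 8) * a) / (p - 1) := by
  obtain ⟨hy0, hya⟩ := hy
  have hp1 : 0 < p - 1 := sub_pos.2 hp
  have hD : 0 < 4 * y ^ 2 + (p - 1) * h := by positivity
  have hD1 : 4 * y ^ 2 ≤ 4 * y ^ 2 + (p - 1) * h := by nlinarith [mul_pos hp1 hh]
  have ha : 0 < a := hy0.trans hya
  have hyh : 0 < y * h := mul_pos hy0 hh
  have hyha : y * h ≤ a * h := by gcongr
  have e1 : p * (1 + 2 * y) * (4 * y ^ 2) ≤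
      p * (1 + 2 * a) * (4 * y ^ 2 + (p - 1) * h) := by gcongr
  have e2 : (p + (6 * p + 8) * a) * h ≤
      (p + (6 * p + 8) * a) / (p - 1) * (4 * y ^ 2 + (p - 1) * h) := by
    rw [div_mul_eq_mul_div, le_div_iff₀ hp1]
    have : 0 < (p + (6 * p + 8) * a) * (4 * y ^ 2) := by positivity
    nlinarith
  have e3 : (6 * p + 8) * (y * h) ≤ (6 * p + 8) * (a * h) := by gcongr
  have e4 : 0 < p * (y * h) := by positivity
  have e5 : 0 < p * (1 + 2 * y) * (4 * y ^ 2) := by positivity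
  have e6 : 0 < p * h := by positivity
  rw [accel, abs_div, abs_of_pos hD, div_le_iff₀ hD, abs_neg, abs_le]
  constructor <;> nlinarith

/-- `H_a` extends continuously to `[0, a]`, with a positive value at `0`. -/
lemma exists_continuous_extension_Ha {p a : ℝ} {G : ℝ → ℝ → ℝ} (hp : 1 < p) (ha : 0 < a)
    (hG : IsGFamily p G) :
    ∃ H : ℝ → ℝ, Continuous H ∧ EqOn (Ha G a) H (Ioc 0 a) ∧ 0 < H 0 := by
  have hC : 0 ≤ 2 * (p * (1 + 2 * a) + (p + (6 * p + 8) * a) / (p - 1)) := by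
    have : 0 < p - 1 := sub_pos.2 hp
    positivity
  have hlip : LipschitzOnWith
      (2 * (p * (1 + 2 * a) + (p + (6 * p + 8) * a) / (p - 1))).toNNReal (Ha G a) (Ioo 0 a) := by
    refine Convex.lipschitzOnWith_of_nnnorm_hasDerivWithin_le (convex_Ioo 0 a)
      (fun t ht => (hasDerivAt_Ha hp ha hG ht).hasDerivWithinAt) fun t ht => ?_
    rw [← NNReal.coe_le_coe, Real.coe_toNNReal _ hC, coe_nnnorm, Real.norm_eq_abs, abs_mul, abs_two]
    exact mul_le_mul_of_nonneg_left (abs_accel_le hp ht (Ha_pos ha hG ht)) zero_le_two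
  obtain ⟨H, hHl, hHe⟩ := hlip.extend_real
  have hHc := hHl.continuous
  refine ⟨H, hHc, hHe.of_subset_closure ?_ hHc.continuousOn Ioo_subset_Ioc_self ?_, ?_⟩
  · refine (continuousOn_pow 2).mul ((hG a ha).1.comp (continuousOn_id.div_const a) ?_)
    exact fun t ht => ⟨div_pos ht.1 ha, (div_le_one ha).2 ht.2⟩
  · rw [closure_Ioo ha.ne]; exact Ioc_subset_Icc_self
  · set δ := min (1 / 2) (a / 2)
    have hδ : δ ∈ Ioo 0 a := ⟨by positivity, (min_le_right _ _).trans_lt (half_lt_self ha)⟩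
    have hder : ∀ t ∈ Ioo 0 δ, HasDerivAt H (2 * accel p t (Ha G a t)) t := by
      intro t ht
      have ht' : t ∈ Ioo 0 a := ⟨ht.1, ht.2.trans hδ.2⟩
      refine (hasDerivAt_Ha hp ha hG ht').congr_of_eventuallyEq ?_
      filter_upwards [Ioo_mem_nhds ht'.1 ht'.2] with u hu using (hHe hu).symm
    have hanti : AntitoneOn H (Icc 0 δ) := by
      refine antitoneOn_of_deriv_nonpos (convex_Icc 0 δ) hHc.continuousOn ?_ ?_
      · rw [interior_Icc]
        exact fun t ht => (hder t ht).differentiableAt.differentiableWithinAt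
      · rw [interior_Icc]
        intro t ht
        rw [(hder t ht).deriv]
        have hh := Ha_pos ha hG (t := t) ⟨ht.1, ht.2.trans hδ.2⟩
        have ht0 := ht.1
        have ht1 : t ≤ 1 / 2 := ht.2.le.trans (min_le_left _ _)
        have hp1 : 0 < p - 1 := sub_pos.2 hp
        refine mul_nonpos_of_nonneg_of_nonpos zero_le_two
          (div_nonpos_of_nonpos_of_nonneg (neg_nonpos.2 ?_) (by positivity))
        have e1 : 0 ≤ p + (6 * p - 8) * t := by nlinarith
        have e2 : 0 ≤ 4 * p * (1 + 2 * t) * t ^ 2 := by positivity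
        nlinarith [mul_nonneg e1 hh.le]
    have h0 := hanti ⟨le_rfl, hδ.1.le⟩ ⟨hδ.1.le, le_rfl⟩ hδ.1.le
    rw [← hHe hδ] at h0
    exact (Ha_pos ha hG hδ).trans_le h0

/-- One step of the regularity bootstrap. -/
lemma contDiffOn_succ_of_hasDerivWithinAt_Icc {f f' : ℝ → ℝ} {a b : ℝ} (hab : a < b) {n : ℕ}
    (hd : ∀ x ∈ Icc a b, HasDerivWithinAt f (f' x) (Icc a b) x)
    (hf' : ContDiffOn ℝ n f' (Icc a b)) : ContDiffOn ℝ (n + 1 : ℕ) f (Icc a b) := by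
  push_cast
  rw [contDiffOn_succ_iff_derivWithin (uniqueDiffOn_Icc hab)]
  refine ⟨fun x hx => (hd x hx).differentiableWithinAt, by simp, hf'.congr fun x hx => ?_⟩
  exact (hd x hx).derivWithin (uniqueDiffOn_Icc hab x hx)

theorem extended_inverse_solves_ODE (p a : ℝ) (hp : 1 < p) (ha : 0 < a)
    (G : ℝ → ℝ → ℝ) (hG : IsGFamily p G) (y : ℝ → ℝ)
    (hmaps : Set.MapsTo y (Set.Icc 0 (thetaA G a)) (Set.Icc 0 a))
    (hinv₁ : ∀ t ∈ Set.Icc 0 a, y (gfun G a t) = t)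
    (hinv₂ : ∀ s ∈ Set.Icc 0 (thetaA G a), gfun G a (y s) = s)
    (heven : ∀ s ∈ Set.Ico (-(thetaA G a)) 0, y s = y (-s)) :
    ContDiffOn ℝ 3 y (Set.Icc (-(thetaA G a)) (thetaA G a)) ∧
    (∀ s ∈ Set.Ioo (-(thetaA G a)) (thetaA G a),
      4*(y s)^2 * (1 + 2*(y s) + deriv (deriv y) s / p)
        + (deriv y s)^2 * (1 + (2*(3*p - 4)/p)*(y s) + ((p - 1)/p)*deriv (deriv y) s)
        = 0) ∧
    (∀ s ∈ Set.Ioo (-(thetaA G a)) (thetaA G a), 0 < y s) ∧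
    y (thetaA G a) = 0 ∧ y (-(thetaA G a)) = 0 ∧
    deriv y 0 = 0 ∧
    deriv (deriv y) 0 = -p*(1 + 2*a) := by
  obtain ⟨H, hHc, hHe, hH0⟩ := exists_continuous_extension_Ha hp ha hG
  have hp0 : p ≠ 0 := by positivity
  have hp1 : 0 < p - 1 := sub_pos.2 hp
  have hHa : H a = 0 := by
    rw [← hHe ⟨ha, le_rfl⟩, Ha, div_self ha.ne', (hG a ha).2.1, mul_zero]
  have hHpos : ∀ t ∈ Ioo 0 a, 0 < H t := fun t ht =>
    hHe (Ioo_subset_Ioc_self ht) ▸ Ha_pos ha hG ht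
  have hHnn : ∀ t ∈ Icc 0 a, 0 ≤ H t := by
    rintro t ⟨h0, h1⟩
    rcases h0.eq_or_lt with rfl | h0
    · exact hH0.le
    rcases h1.eq_or_lt with rfl | h1
    · exact hHa.ge
    exact (hHpos t ⟨h0, h1⟩).le
  have hHd : ∀ t ∈ Ioo 0 a, HasDerivAt H (2 * accel p t (H t)) t := by
    intro t ht
    have h := hasDerivAt_Ha hp ha hG ht
    rw [hHe (Ioo_subset_Ioc_self ht)] at h
    refine h.congr_of_eventuallyEq ?_
    filter_upwards [Ioo_mem_nhds ht.1 ht.2] with u hu using (hHe (Ioo_subset_Ioc_self hu)).symm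
  set k : ℝ → ℝ := fun w => (√(H w))⁻¹ with hk
  have hgset : ∀ t ∈ Icc 0 a, gfun G a t = ∫ w in Ioo t a, k w := fun t ht =>
    setIntegral_congr_fun measurableSet_Ioo fun w hw => by
      simp only [hk]
      rw [hHe ⟨ht.1.trans_lt hw.1, hw.2.le⟩]
  have hg : ∀ t ∈ Icc 0 a, gfun G a t = ∫ w in t..a, k w := fun t ht => by
    rw [hgset t ht, intervalIntegral.integral_of_le ht.2, integral_Ioc_eq_integral_Ioo]
  have hga : gfun G a a = 0 := by rw [hg a ⟨ha.le, le_rfl⟩, intervalIntegral.integral_same]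
  have hya : y 0 = a := hga ▸ hinv₁ a ⟨ha.le, le_rfl⟩
  have hint : IntervalIntegrable k volume 0 a := by
    by_contra hni
    have h0 := hinv₁ 0 ⟨le_rfl, ha.le⟩
    rw [hg 0 ⟨le_rfl, ha.le⟩, intervalIntegral.integral_undef hni, hya] at h0
    exact ha.ne' h0
  obtain ⟨hθ, hyc, hyI, hyd⟩ := inverse_of_primitive (k := k) (g := gfun G a) (y := y) ha
    (fun t ht => ((hHc.sqrt.continuousAt).inv₀
      (Real.sqrt_pos.2 (hHpos t ht)).ne').continuousWithinAt)
    (fun t ht => inv_pos.2 (Real.sqrt_pos.2 (hHpos t ht))) hint hg hmaps hinv₁ hinv₂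
  have hyθ : y (thetaA G a) = 0 := hinv₁ 0 ⟨le_rfl, ha.le⟩
  change 0 < thetaA G a at hθ
  change ContinuousOn y (Icc 0 (thetaA G a)) at hyc
  change ∀ s ∈ Ioo 0 (thetaA G a), y s ∈ Ioo 0 a at hyI
  change ∀ s ∈ Ioo 0 (thetaA G a), HasDerivAt y (-(k (y s))⁻¹) s at hyd
  set θ := thetaA G a
  simp only [hk, inv_inv] at hyd
  have hneg : ∀ s ∈ Icc (-θ) 0, y s = y (-s) := by
    rintro s ⟨h0, h1⟩
    rcases h1.eq_or_lt with rfl | h1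
    · rw [neg_zero]
    · exact heven s ⟨h0, h1⟩
  have hmapneg : MapsTo (fun s : ℝ => -s) (Icc (-θ) 0) (Icc 0 θ) := fun s hs =>
    ⟨neg_nonneg.2 hs.2, neg_le.1 hs.1⟩
  have hycneg : ContinuousOn y (Icc (-θ) 0) :=
    (hyc.comp continuousOn_neg hmapneg).congr hneg
  have hunion : Icc (-θ) 0 ∪ Icc 0 θ = Icc (-θ) θ :=
    Icc_union_Icc_eq_Icc (neg_nonpos.2 hθ.le) hθ.le
  have hyC : ContinuousOn y (Icc (-θ) θ) := by
    rw [← hunion]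
    exact hycneg.union_of_isClosed hyc isClosed_Icc isClosed_Icc
  set v : ℝ → ℝ := fun s => if s ≤ 0 then √(H (y s)) else -√(H (y s)) with hv
  have hv_nonpos : ∀ s, s ≤ 0 → v s = √(H (y s)) := fun s hs => if_pos hs
  have hv0 : v 0 = 0 := by rw [hv_nonpos 0 le_rfl, hya, hHa, Real.sqrt_zero]
  have hv_nonneg : ∀ s, 0 ≤ s → v s = -√(H (y s)) := by
    intro s hs
    rcases hs.eq_or_lt with rfl | hs
    · rw [hv0, hya, hHa, Real.sqrt_zero, neg_zero]
    · exact if_neg hs.not_ge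
  have hvC : ContinuousOn v (Icc (-θ) θ) := by
    rw [← hunion]
    refine ContinuousOn.union_of_isClosed ?_ ?_ isClosed_Icc isClosed_Icc
    · exact (hHc.sqrt.comp_continuousOn hycneg).congr fun s hs => hv_nonpos s hs.2
    · exact (hHc.sqrt.comp_continuousOn hyc).neg.congr fun s hs => hv_nonneg s hs.1
  have hyIcc : ∀ s ∈ Icc (-θ) θ, y s ∈ Icc 0 a := by
    intro s hs
    rcases le_total s 0 with h | h
    · rw [hneg s ⟨hs.1, h⟩]; exact hmaps (hmapneg ⟨hs.1, h⟩)
    · exact hmaps ⟨h, hs.2⟩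
  have hvsq : ∀ s ∈ Icc (-θ) θ, v s ^ 2 = H (y s) := by
    intro s hs
    have h := Real.sq_sqrt (hHnn _ (hyIcc s hs))
    rcases le_total s 0 with h' | h'
    · rw [hv_nonpos s h', h]
    · rw [hv_nonneg s h', neg_sq, h]
  have hsmall : ∀ s ∈ Ioo (-θ) θ, s ≠ 0 → y s ∈ Ioo 0 a := by
    intro s hs hs0
    rcases hs0.lt_or_gt with h | h
    · rw [hneg s ⟨hs.1.le, h.le⟩]
      exact hyI _ ⟨neg_pos.2 h, neg_lt.1 hs.1⟩
    · exact hyI s ⟨h, hs.2⟩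
  have hypos : ∀ s ∈ Ioo (-θ) θ, 0 < y s := by
    intro s hs
    rcases eq_or_ne s 0 with rfl | h
    · rwa [hya]
    · exact (hsmall s hs h).1
  have hyneg : y (-θ) = 0 := by
    rw [heven (-θ) ⟨le_rfl, neg_neg_of_pos hθ⟩, neg_neg, hyθ]
  have hden : ∀ s ∈ Icc (-θ) θ, 0 < 4 * y s ^ 2 + (p - 1) * v s ^ 2 := by
    intro s hs
    rcases (hyIcc s hs).1.eq_or_lt with h | h
    · rw [hvsq s hs, ← h]
      positivity
    · positivity
  have hyD : ∀ s ∈ Ioo (-θ) θ, s ≠ 0 → HasDerivAt y (v s) s := by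
    intro s hs hs0
    rcases hs0.lt_or_gt with h | h
    · have hs' : -s ∈ Ioo 0 θ := ⟨neg_pos.2 h, neg_lt.1 hs.1⟩
      have hd := (hyd (-s) hs').comp s (hasDerivAt_neg s)
      rw [← hneg s ⟨hs.1.le, h.le⟩, neg_mul_neg, mul_one, ← hv_nonpos s h.le] at hd
      refine hd.congr_of_eventuallyEq ?_
      filter_upwards [Ioo_mem_nhds hs.1 h] with u hu using hneg u (Ioo_subset_Icc_self hu)
    · rw [hv_nonneg s h.le]
      exact hyd s ⟨h, hs.2⟩
  have hsqrtD : ∀ s ∈ Ioo (-θ) θ, s ≠ 0 → HasDerivAt (fun u => √(H (y u)))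
      (2 * accel p (y s) (H (y s)) * v s / (2 * √(H (y s)))) s := fun s hs hs0 =>
    (((hHd _ (hsmall s hs hs0)).comp s (hyD s hs hs0)).sqrt
      (hHpos _ (hsmall s hs hs0)).ne')
  set φ : ℝ → ℝ := fun s => accel p (y s) (v s ^ 2) with hφ
  have hvD : ∀ s ∈ Ioo (-θ) θ, s ≠ 0 → HasDerivAt v (φ s) s := by
    intro s hs hs0
    have hd := hsqrtD s hs hs0
    have hne := (Real.sqrt_pos.2 (hHpos _ (hsmall s hs hs0))).ne'
    simp only [hφ]
    rw [hvsq s (Ioo_subset_Icc_self hs)]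
    rcases hs0.lt_or_gt with h | h
    · refine (hd.congr_deriv ?_).congr_of_eventuallyEq ?_
      · rw [hv_nonpos s h.le]
        field_simp
      · filter_upwards [Iio_mem_nhds h] with u hu using hv_nonpos u (le_of_lt hu)
    · refine (hd.neg.congr_deriv ?_).congr_of_eventuallyEq ?_
      · rw [hv_nonneg s h.le]
        field_simp
      · filter_upwards [Ioi_mem_nhds h] with u hu using hv_nonneg u (le_of_lt hu)
  have hφ_contDiff : ∀ n : ℕ, ContDiffOn ℝ n y (Icc (-θ) θ) → ContDiffOn ℝ n v (Icc (-θ) θ) →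
      ContDiffOn ℝ n φ (Icc (-θ) θ) := by
    intro n hy hv
    refine ContDiffOn.div ?_ ?_ fun s hs => (hden s hs).ne'
    · fun_prop
    · fun_prop
  have hφC : ContinuousOn φ (Icc (-θ) θ) :=
    (hφ_contDiff 0 (contDiffOn_zero.2 hyC) (contDiffOn_zero.2 hvC)).continuousOn
  have hyW : ∀ s ∈ Icc (-θ) θ, HasDerivWithinAt y (v s) (Icc (-θ) θ) s := fun s hs =>
    hasDerivWithinAt_Icc_of_hasDerivAt_off_point hyC hvC hyD hs
  have hvW : ∀ s ∈ Icc (-θ) θ, HasDerivWithinAt v (φ s) (Icc (-θ) θ) s := fun s hs =>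
    hasDerivWithinAt_Icc_of_hasDerivAt_off_point hvC hφC hvD hs
  have hlt : -θ < θ := neg_lt_self hθ
  have hsmooth : ∀ n : ℕ, ContDiffOn ℝ n y (Icc (-θ) θ) ∧ ContDiffOn ℝ n v (Icc (-θ) θ) := by
    intro n
    induction n with
    | zero => exact ⟨contDiffOn_zero.2 hyC, contDiffOn_zero.2 hvC⟩
    | succ n ih =>
      exact ⟨contDiffOn_succ_of_hasDerivWithinAt_Icc hlt hyW ih.2,
        contDiffOn_succ_of_hasDerivWithinAt_Icc hlt hvW (hφ_contDiff n ih.1 ih.2)⟩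
  have hderiv : ∀ s ∈ Ioo (-θ) θ, deriv y s = v s := fun s hs =>
    ((hyW s (Ioo_subset_Icc_self hs)).hasDerivAt (Icc_mem_nhds hs.1 hs.2)).deriv
  have hderiv2 : ∀ s ∈ Ioo (-θ) θ, deriv (deriv y) s = φ s := by
    intro s hs
    refine (((hvW s (Ioo_subset_Icc_self hs)).hasDerivAt
      (Icc_mem_nhds hs.1 hs.2)).congr_of_eventuallyEq ?_).deriv
    filter_upwards [Ioo_mem_nhds hs.1 hs.2] with u hu using hderiv u hu
  have h0mem : (0 : ℝ) ∈ Ioo (-θ) θ := ⟨neg_neg_of_pos hθ, hθ⟩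
  refine ⟨(hsmooth 3).1, fun s hs => ?_, hypos, hyθ, hyneg, ?_, ?_⟩
  · rw [hderiv s hs, hderiv2 s hs]
    have hD := (hden s (Ioo_subset_Icc_self hs)).ne'
    simp only [hφ, accel]
    generalize hDe : 4 * y s ^ 2 + (p - 1) * v s ^ 2 = D at *
    field_simp
    subst hDe
    ring
  · rw [hderiv 0 h0mem, hv0]
  · rw [hderiv2 0 h0mem]
    simp only [hφ, accel]
    rw [hv0, hya]
    field_simp
    ring
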